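/- In the weighted set cover problem, for every nonempty subset B ⊆ A and every vector x = (x₁,...,x_t) of nonnegative reals satisfying Σ_{i : a ∈ S_i} x_i ≥ 1 for every a ∈ A, one has |B|·η(B) ≤ Σ_{i=1}^t c(S_i)·x_i. In particular, taking x to be the indicator vector of an optimal cover, η* ≤ OPT. -/

import Mathlib

open Finset

section SetCover

variable {γ : Type*} [DecidableEq γ]

/-- `η(B)`: the minimum of `c(Sᵢ)/|Sᵢ ∩ B|` over those `i` with `Sᵢ ∩ B ≠ ∅`. -/
noncomputable def eta {t : ℕ} (S : Fin t → Finset γ) (c : Fin t → ℝ) (B : Finset γ) : ℝ :=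
  sInf {r | ∃ i, (S i ∩ B).Nonempty ∧ r = c i / ((S i ∩ B).card : ℝ)}

/-- `η*`: the maximum of `|B| · η(B)` over nonempty subsets `B` of the universe `A`. -/
noncomputable def etaStar {t : ℕ} (A : Finset γ) (S : Fin t → Finset γ)
    (c : Fin t → ℝ) : ℝ :=
  sSup {r | ∃ B : Finset γ, B.Nonempty ∧ B ⊆ A ∧ r = (B.card : ℝ) * eta S c B}

/-- `OPT`: the minimum total cost of a subcollection of the `Sᵢ` covering `A`. -/
noncomputable def setCoverOPT {t : ℕ} (A : Finset γ) (S : Fin t → Finset γ)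
    (c : Fin t → ℝ) : ℝ :=
  sInf {r | ∃ C : Finset (Fin t), (∀ a ∈ A, ∃ i ∈ C, a ∈ S i) ∧ r = ∑ i ∈ C, c i}

end SetCover

section SetCover

variable {γ : Type*} [DecidableEq γ] {t : ℕ} {S : Fin t → Finset γ} {c : Fin t → ℝ}

theorem eta_nonneg (hc : ∀ i, 0 ≤ c i) (B : Finset γ) : 0 ≤ eta S c B := by
  apply Real.sInf_nonneg
  rintro r ⟨i, -, rfl⟩
  exact div_nonneg (hc i) (Nat.cast_nonneg _)

theorem card_inter_mul_eta_le (hc : ∀ i, 0 ≤ c i) (B : Finset γ) (i : Fin t) :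
    ((S i ∩ B).card : ℝ) * eta S c B ≤ c i := by
  rcases (S i ∩ B).eq_empty_or_nonempty with h | h
  · simpa [h] using hc i
  · rw [mul_comm, ← le_div_iff₀ (Nat.cast_pos.mpr h.card_pos)]
    refine csInf_le ⟨0, ?_⟩ ⟨i, h, rfl⟩
    rintro r ⟨j, -, rfl⟩
    exact div_nonneg (hc j) (Nat.cast_nonneg _)

/-- Double counting of the pairs `(a, i)` with `a ∈ S i ∩ B`, weighted by `x i`. -/
theorem sum_sum_filter_mem_eq (B : Finset γ) (x : Fin t → ℝ) :
    ∑ a ∈ B, ∑ i ∈ univ.filter (fun i => a ∈ S i), x i =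
      ∑ i, ((S i ∩ B).card : ℝ) * x i := by
  simp_rw [sum_filter]
  rw [sum_comm]
  refine sum_congr rfl fun i _ => ?_
  rw [← sum_filter, sum_const, nsmul_eq_mul, filter_mem_eq_inter, inter_comm]

theorem card_mul_eta_le_sum (hc : ∀ i, 0 ≤ c i) (B : Finset γ) {x : Fin t → ℝ}
    (hx : ∀ i, 0 ≤ x i)
    (hcov : ∀ a ∈ B, 1 ≤ ∑ i ∈ univ.filter (fun i => a ∈ S i), x i) :
    (B.card : ℝ) * eta S c B ≤ ∑ i, c i * x i := by
  have hcard : (B.card : ℝ) ≤ ∑ i, ((S i ∩ B).card : ℝ) * x i := by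
    rw [← sum_sum_filter_mem_eq, card_eq_sum_ones, Nat.cast_sum]
    exact sum_le_sum fun a ha => by simpa using hcov a ha
  calc (B.card : ℝ) * eta S c B
      ≤ (∑ i, ((S i ∩ B).card : ℝ) * x i) * eta S c B :=
        mul_le_mul_of_nonneg_right hcard (eta_nonneg hc B)
    _ = ∑ i, ((S i ∩ B).card : ℝ) * eta S c B * x i := by
        rw [sum_mul]
        exact sum_congr rfl fun i _ => mul_right_comm _ _ _
    _ ≤ ∑ i, c i * x i :=
        sum_le_sum fun i _ => mul_le_mul_of_nonneg_right (card_inter_mul_eta_le hc B i) (hx i)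

theorem one_le_sum_indicator_of_cover {C : Finset (Fin t)} {a : γ} (h : ∃ i ∈ C, a ∈ S i) :
    (1 : ℝ) ≤ ∑ i ∈ univ.filter (fun i => a ∈ S i), if i ∈ C then 1 else 0 := by
  obtain ⟨i, hiC, hi⟩ := h
  have := single_le_sum (s := univ.filter (fun i => a ∈ S i))
    (f := fun i => if i ∈ C then (1 : ℝ) else 0)
    (fun j _ => by positivity) (mem_filter.mpr ⟨mem_univ i, hi⟩)
  simpa only [if_pos hiC] using this

end SetCover

/-- in the weighted set cover problem, for every nonempty `B ⊆ A` and every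
nonnegative fractional cover `x`, one has `|B| · η(B) ≤ ∑ᵢ c(Sᵢ) · xᵢ`; in particular
`η* ≤ OPT`. -/
theorem card_mul_eta_le_lp_cost {γ : Type*} [DecidableEq γ] {t : ℕ}
    (A : Finset γ) (hA : A.Nonempty)
    (S : Fin t → Finset γ) (hSsub : ∀ i, S i ⊆ A) (hScov : ∀ a ∈ A, ∃ i, a ∈ S i)
    (c : Fin t → ℝ) (hc : ∀ i, 0 < c i) :
    (∀ B : Finset γ, B.Nonempty → B ⊆ A →
      ∀ x : Fin t → ℝ, (∀ i, 0 ≤ x i) →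
        (∀ a ∈ A, 1 ≤ ∑ i ∈ Finset.univ.filter (fun i => a ∈ S i), x i) →
        (B.card : ℝ) * eta S c B ≤ ∑ i, c i * x i) ∧
    etaStar A S c ≤ setCoverOPT A S c := by
  have hc' : ∀ i, 0 ≤ c i := fun i => (hc i).le
  refine ⟨fun B _ hBA x hx hcov => card_mul_eta_le_sum hc' B hx fun a ha => hcov a (hBA ha), ?_⟩
  refine csSup_le ⟨_, A, hA, Subset.rfl, rfl⟩ ?_
  rintro _ ⟨B, -, hBA, rfl⟩
  refine le_csInf ⟨_, univ, fun a ha => by simpa using hScov a ha, rfl⟩ ?_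
  rintro _ ⟨C, hC, rfl⟩
  simpa using card_mul_eta_le_sum (x := fun i => if i ∈ C then 1 else 0) hc' B
    (fun i => by positivity) fun a ha => one_le_sum_indicator_of_cover (hC a (hBA ha))
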